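/- For every n ≥ 3 and g ∈ ℕ, the space Σ̄_{n,g} is the direct sum of its subspace O_{n,g} := Σ̄_{n,g} ∩ qₙ·Aₙ and the ℂ-span of the monomials ē₂^{h₂}⋯ēₙ^{hₙ} with 2h₂+3h₃+⋯+nhₙ = g and (h₂,…,hₙ) ⋡ 𝐧 (i.e. not componentwise ≥ 𝐧). -/

import Mathlib

open MvPolynomial

noncomputable section

/-- `λ̄ᵢ` (`i = 1,…,n`) in `Aₙ = ℂ[λ₁,…,λₙ]/(λ₁+⋯+λₙ)`, identified with the polynomial
ring `ℂ[λ̄₁,…,λ̄_{n-1}]` via `λ̄ₙ = −(λ̄₁+⋯+λ̄_{n-1})`. -/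
def lamb (n : ℕ) (i : Fin n) : MvPolynomial (Fin (n - 1)) ℂ :=
  if h : (i : ℕ) < n - 1 then X ⟨(i : ℕ), h⟩ else -(∑ j : Fin (n - 1), X j)

/-- `λ̄_T := ∑_{i∈T} λ̄ᵢ` for a subset `T ⊆ {1,…,n}`. -/
def lamT (n : ℕ) (T : Finset (Fin n)) : MvPolynomial (Fin (n - 1)) ℂ :=
  ∑ i ∈ T, lamb n i

/-- `p_h`: for `2h < n` the product of the `λ̄_T` over all `T` with `|T| = h`; for
`n = 2h` the product over those `T` with `|T| = h` containing the first index. -/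
def pP (n h : ℕ) : MvPolynomial (Fin (n - 1)) ℂ :=
  if 2 * h < n then ∏ T ∈ Finset.powersetCard h (Finset.univ : Finset (Fin n)), lamT n T
  else ∏ T ∈ (Finset.powersetCard h (Finset.univ : Finset (Fin n))).filter
      (fun T => ∃ i : Fin n, i ∈ T ∧ (i : ℕ) = 0), lamT n T

/-- `qₙ := p₁ p₂ ⋯ p_m`, `m = ⌊n/2⌋`. -/
def qP (n : ℕ) : MvPolynomial (Fin (n - 1)) ℂ :=
  ∏ h ∈ Finset.Icc 1 (n / 2), pP n h

/-- The induced `Sₙ`-action on `Aₙ ≅ ℂ[λ̄₁,…,λ̄_{n-1}]`, permuting `λ̄₁,…,λ̄ₙ`. -/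
def permAct (n : ℕ) (σ : Equiv.Perm (Fin n)) :
    MvPolynomial (Fin (n - 1)) ℂ →ₐ[ℂ] MvPolynomial (Fin (n - 1)) ℂ :=
  aeval (fun j : Fin (n - 1) => lamb n (σ (Fin.castLE (Nat.sub_le n 1) j)))

/-- `Σ̄_{n,g}`: the `Sₙ`-invariant elements of `Aₙ ≅ ℂ[λ̄₁,…,λ̄_{n-1}]` homogeneous of
degree `g`. -/
def SigmaBar (n g : ℕ) : Submodule ℂ (MvPolynomial (Fin (n - 1)) ℂ) :=
  homogeneousSubmodule (Fin (n - 1)) ℂ g ⊓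
    ⨅ σ : Equiv.Perm (Fin n),
      LinearMap.ker ((permAct n σ).toLinearMap - LinearMap.id)

/-- `ēⱼ`: the image in `ℂ[λ̄₁,…,λ̄_{n-1}]` of the `j`-th elementary symmetric
polynomial `eⱼ(λ₁,…,λₙ)`. -/
def ebar (n j : ℕ) : MvPolynomial (Fin (n - 1)) ℂ :=
  ∑ T ∈ Finset.powersetCard j (Finset.univ : Finset (Fin n)), ∏ i ∈ T, lamb n i

/-- The tuple `𝐧 = (0, 2^{n-4}, 2^{n-5}, …, 2, 1, 1) ∈ ℕ^{n-1}` (for `n > 3`),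
resp. `𝐧 = (0,1)` for `n = 3`. -/
def nvec (n : ℕ) : Fin (n - 1) → ℕ :=
  fun i => if (i : ℕ) = 0 then 0
    else if (i : ℕ) = n - 2 then 1 else 2 ^ (n - (i : ℕ) - 3)

/-- `a` is the colexicographically smallest exponent occurring in `f`. -/
def HasTrailingExp {m : ℕ} (f : MvPolynomial (Fin m) ℂ) (a : Fin m →₀ ℕ) : Prop :=
  coeff a f ≠ 0 ∧ ∀ b, coeff b f ≠ 0 → toColex a ≤ toColex b

lemma exists_hasTrailingExp {m : ℕ} {f : MvPolynomial (Fin m) ℂ} (hf : f ≠ 0) :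
    ∃ a, HasTrailingExp f a := by
  obtain ⟨a, ha, h⟩ := f.support.exists_min_image (fun b => toColex b)
    (support_nonempty.mpr hf)
  exact ⟨a, mem_support_iff.mp ha, fun b hb => h b (mem_support_iff.mpr hb)⟩

lemma HasTrailingExp.mul {m : ℕ} {f g : MvPolynomial (Fin m) ℂ} {a b : Fin m →₀ ℕ}
    (hf : HasTrailingExp f a) (hg : HasTrailingExp g b) : HasTrailingExp (f * g) (a + b) := by
  classical
  constructor
  · rw [coeff_mul, Finset.sum_eq_single (a, b)]
    · exact mul_ne_zero hf.1 hg.1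
    · rintro ⟨u, v⟩ huv hne
      by_contra h
      have hu := hf.2 u (left_ne_zero_of_mul h)
      have hv := hg.2 v (right_ne_zero_of_mul h)
      have huv' : u + v = a + b := Finset.HasAntidiagonal.mem_antidiagonal.mp huv
      have hua' : a = u := by
        by_contra hne'
        have hlt : toColex a < toColex u := lt_of_le_of_ne hu fun h => hne' (toColex.injective h)
        have hs := add_lt_add_of_lt_of_le hlt hv
        rw [← toColex_add, ← toColex_add, huv'] at hs
        exact lt_irrefl _ hs
      subst hua'
      have := add_left_cancel huv'
      exact hne (by rw [← this])
    · intro h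
      exact absurd (by simp) h
  · intro c hc
    rw [coeff_mul] at hc
    obtain ⟨⟨u, v⟩, huv, h⟩ := Finset.exists_ne_zero_of_sum_ne_zero hc
    rw [← Finset.HasAntidiagonal.mem_antidiagonal.mp huv, toColex_add, toColex_add]
    exact add_le_add (hf.2 u (left_ne_zero_of_mul h)) (hg.2 v (right_ne_zero_of_mul h))

lemma hasTrailingExp_monomial {m : ℕ} (a : Fin m →₀ ℕ) {c : ℂ} (hc : c ≠ 0) :
    HasTrailingExp (monomial a c) a := by
  classical
  refine ⟨by simpa using hc, fun b hb => ?_⟩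
  rw [coeff_monomial] at hb
  have : a = b := by by_contra h; simp [h] at hb
  rw [this]

/-- Substitute `0` for the last variable. -/
def killLast (m : ℕ) : MvPolynomial (Fin (m + 1)) ℂ →ₐ[ℂ] MvPolynomial (Fin m) ℂ :=
  aeval (Fin.snoc (α := fun _ => MvPolynomial (Fin m) ℂ) X 0)

/-- Append a last exponent. -/
def snocExp {m : ℕ} (a : Fin m →₀ ℕ) (j : ℕ) : Fin (m + 1) →₀ ℕ :=
  Finsupp.equivFunOnFinite.symm (Fin.snoc (α := fun _ => ℕ) a j)

lemma exists_eq_snocExp {m : ℕ} (b : Fin (m + 1) →₀ ℕ) : ∃ a j, b = snocExp a j := by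
  refine ⟨Finsupp.equivFunOnFinite.symm (Fin.init b), b (Fin.last m), ?_⟩
  ext i
  refine Fin.lastCases ?_ (fun i => ?_) i <;> simp [snocExp]

lemma killLast_monomial {m : ℕ} (a : Fin m →₀ ℕ) (j : ℕ) (c : ℂ) :
    killLast m (monomial (snocExp a j) c) = if j = 0 then monomial a c else 0 := by
  rw [killLast, aeval_monomial, Finsupp.prod_fintype _ _ (by simp), Fin.prod_univ_castSucc]
  simp only [snocExp, Finsupp.equivFunOnFinite_symm_apply_apply, Fin.snoc_castSucc, Fin.snoc_last]
  split_ifs with h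
  · rw [monomial_eq (s := a), Finsupp.prod_fintype _ _ (by simp)]
    simp [h, algebraMap_eq]
  · simp [h]

lemma snocExp_injective {m : ℕ} {a b : Fin m →₀ ℕ} {j l : ℕ} (h : snocExp a j = snocExp b l) :
    a = b ∧ j = l := by
  constructor
  · ext i
    simpa [snocExp] using DFunLike.congr_fun h i.castSucc
  · simpa [snocExp] using DFunLike.congr_fun h (Fin.last m)

lemma coeff_killLast {m : ℕ} (f : MvPolynomial (Fin (m + 1)) ℂ) (a : Fin m →₀ ℕ) :
    coeff a (killLast m f) = coeff (snocExp a 0) f := by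
  classical
  induction f using MvPolynomial.induction_on' with
  | monomial u c =>
    obtain ⟨b, j, rfl⟩ := exists_eq_snocExp u
    rw [killLast_monomial, coeff_monomial]
    by_cases hj : j = 0
    · subst hj
      rw [if_pos rfl, coeff_monomial]
      by_cases hab : b = a
      · simp [hab]
      · rw [if_neg hab, if_neg fun h => hab (snocExp_injective h).1]
    · rw [if_neg hj, if_neg fun h => hj (snocExp_injective h).2, coeff_zero]
  | add p q hp hq => rw [map_add, coeff_add, coeff_add, hp, hq]

lemma HasTrailingExp.of_killLast {m : ℕ} {f : MvPolynomial (Fin (m + 1)) ℂ} {a : Fin m →₀ ℕ}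
    (h : HasTrailingExp (killLast m f) a) : HasTrailingExp f (snocExp a 0) := by
  refine ⟨coeff_killLast f a ▸ h.1, fun b hb => ?_⟩
  obtain ⟨b, j, rfl⟩ := exists_eq_snocExp b
  rcases Nat.eq_zero_or_pos j with rfl | hj
  · rw [← coeff_killLast] at hb
    rcases (h.2 b hb).eq_or_lt with hab | hab
    · rw [toColex.injective hab]
    · refine le_of_lt ?_
      rw [Finsupp.Colex.lt_iff] at hab ⊢
      obtain ⟨i, h1, h2⟩ := hab
      refine ⟨i.castSucc, fun l hl => ?_, by simpa [snocExp] using h2⟩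
      induction l using Fin.lastCases with
      | last => simp [snocExp]
      | cast l => simpa [snocExp] using h1 l (by simpa using hl)
  · refine le_of_lt ?_
    rw [Finsupp.Colex.lt_iff]
    refine ⟨Fin.last m, fun l hl => absurd (Fin.le_last l) (not_le.mpr hl), ?_⟩
    simpa [snocExp] using hj

/-- The product of all `x_T` with `T` a nonempty proper subset of the index set. -/
def properProd {K : Type*} [CommRing K] {k : ℕ} (x : Fin k → K) : K :=
  ∏ T : Finset (Fin k) with T.Nonempty ∧ T ≠ Finset.univ, ∑ i ∈ T, x i

lemma properProd_comp_perm {K : Type*} [CommRing K] {k : ℕ} (x : Fin k → K)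
    (σ : Equiv.Perm (Fin k)) : properProd (x ∘ σ) = properProd x := by
  refine Finset.prod_equiv σ.finsetCongr (fun T => ?_) (fun T _ => ?_)
  · simp only [Finset.mem_filter, Finset.mem_univ, true_and, Equiv.finsetCongr_apply,
      Finset.map_nonempty]
    refine and_congr_right fun _ => not_congr ?_
    rw [← Finset.card_eq_iff_eq_univ, ← Finset.card_eq_iff_eq_univ, Finset.card_map]
  · simp

lemma sum_compl_eq_neg {K : Type*} [CommRing K] {k : ℕ} {x : Fin k → K} (hx : ∑ i, x i = 0)
    (T : Finset (Fin k)) : ∑ i ∈ Tᶜ, x i = -∑ i ∈ T, x i :=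
  eq_neg_of_add_eq_zero_right ((Finset.sum_add_sum_compl T x).trans hx)

/-- If `F` contains exactly one of `T`, `Tᶜ` for every nonempty proper subset `T`, then the product
over all nonempty proper subsets is, up to sign, the square of the product over `F`. -/
lemma properProd_eq_sq {K : Type*} [CommRing K] {k : ℕ} {x : Fin k → K} (hx : ∑ i, x i = 0)
    (F : Finset (Finset (Fin k))) (hF : ∀ T ∈ F, T.Nonempty ∧ T ≠ Finset.univ)
    (hF' : ∀ T : Finset (Fin k), T.Nonempty → T ≠ Finset.univ → (T ∈ F ↔ Tᶜ ∉ F)) :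
    properProd x = (-1) ^ F.card * (∏ T ∈ F, ∑ i ∈ T, x i) ^ 2 := by
  have hdisj : Disjoint F (F.image compl) := by
    rw [Finset.disjoint_left]
    intro T hT hT'
    obtain ⟨U, hU, rfl⟩ := Finset.mem_image.mp hT'
    have := (hF' _ (hF _ hT).1 (hF _ hT).2).mp hT
    rw [compl_compl] at this
    exact this hU
  have hunion : (Finset.univ.filter fun T : Finset (Fin k) => T.Nonempty ∧ T ≠ Finset.univ)
      = F ∪ F.image compl := by
    ext T
    simp only [Finset.mem_filter, Finset.mem_univ, true_and, Finset.mem_union, Finset.mem_image]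
    constructor
    · rintro ⟨h1, h2⟩
      by_cases h : T ∈ F
      · exact Or.inl h
      · refine Or.inr ⟨Tᶜ, ?_, compl_compl T⟩
        by_contra hc
        exact h ((hF' T h1 h2).mpr hc)
    · rintro (h | ⟨U, hU, rfl⟩)
      · exact hF T h
      · obtain ⟨h1, h2⟩ := hF U hU
        refine ⟨?_, ?_⟩
        · rwa [Finset.nonempty_iff_ne_empty, Ne, Finset.compl_eq_empty_iff]
        · rwa [Ne, Finset.compl_eq_univ_iff, ← Ne, ← Finset.nonempty_iff_ne_empty]
  rw [properProd, hunion, Finset.prod_union hdisj,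
    Finset.prod_image (fun _ _ _ _ h => compl_injective h)]
  simp_rw [sum_compl_eq_neg hx]
  rw [Finset.prod_neg]
  ring

/-- The nonempty subsets avoiding the last index. -/
def halfFamily (k : ℕ) : Finset (Finset (Fin (k + 1))) :=
  Finset.univ.filter fun T => T.Nonempty ∧ Fin.last k ∉ T

/-- The subsets avoiding the last index which have at least `2` and at most `k - 1` elements. -/
def midFamily (k : ℕ) : Finset (Finset (Fin (k + 1))) :=
  Finset.univ.filter fun T => 2 ≤ T.card ∧ T.card + 1 ≤ k ∧ Fin.last k ∉ T

/-- The product of the `x_T`, `T` ranging over `halfFamily`. -/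
def halfProd {K : Type*} [CommRing K] {k : ℕ} (x : Fin (k + 1) → K) : K :=
  ∏ T ∈ halfFamily k, ∑ i ∈ T, x i

/-- The product of the `x_T`, `T` ranging over `midFamily`. -/
def midProd {K : Type*} [CommRing K] {k : ℕ} (x : Fin (k + 1) → K) : K :=
  ∏ T ∈ midFamily k, ∑ i ∈ T, x i

lemma properProd_eq_halfProd_sq {K : Type*} [CommRing K] {k : ℕ} {x : Fin (k + 1) → K}
    (hx : ∑ i, x i = 0) :
    properProd x = (-1) ^ (halfFamily k).card * halfProd x ^ 2 := by
  refine properProd_eq_sq hx _ (fun T hT => ?_) (fun T h1 h2 => ?_)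
  · simp only [halfFamily, Finset.mem_filter, Finset.mem_univ, true_and] at hT
    exact ⟨hT.1, fun h => hT.2 (h ▸ Finset.mem_univ _)⟩
  · have : Tᶜ.Nonempty := by rwa [Finset.nonempty_iff_ne_empty, Ne, Finset.compl_eq_empty_iff]
    simp [halfFamily, h1, this]

lemma card_le_of_last_notMem {k : ℕ} {T : Finset (Fin (k + 1))} (h : Fin.last k ∉ T) :
    T.card ≤ k := by
  have := Finset.card_lt_univ_of_notMem h
  simp only [Fintype.card_fin] at this
  omega

lemma eq_compl_last_of_card {k : ℕ} {T : Finset (Fin (k + 1))} (h : Fin.last k ∉ T)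
    (hc : T.card = k) : T = {Fin.last k}ᶜ := by
  refine Finset.eq_of_subset_of_card_le (fun i hi => ?_) ?_
  · simp only [Finset.mem_compl, Finset.mem_singleton]
    rintro rfl
    exact h hi
  · rw [Finset.card_compl, hc]; simp

lemma halfProd_eq {K : Type*} [CommRing K] {k : ℕ} (hk : 2 ≤ k) {x : Fin (k + 1) → K}
    (hx : ∑ i, x i = 0) : halfProd x = -((∏ i, x i) * midProd x) := by
  have hfam : halfFamily k = insert {Fin.last k}ᶜ
      ((Finset.univ.image fun i : Fin k => {i.castSucc}) ∪ midFamily k) := by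
    ext T
    simp only [halfFamily, midFamily, Finset.mem_filter, Finset.mem_univ, true_and,
      Finset.mem_insert, Finset.mem_union, Finset.mem_image]
    constructor
    · rintro ⟨h1, h2⟩
      have h3 := Finset.card_pos.mpr h1
      have h4 := card_le_of_last_notMem h2
      rcases Nat.lt_or_ge T.card 2 with h | h
      · obtain ⟨i, rfl⟩ := Finset.card_eq_one.mp (by omega : T.card = 1)
        refine Or.inr (Or.inl ?_)
        induction i using Fin.lastCases with
        | last => simp at h2
        | cast i => exact ⟨i, rfl⟩
      · rcases Nat.lt_or_ge T.card k with h' | h'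
        · exact Or.inr (Or.inr ⟨h, h', h2⟩)
        · exact Or.inl (eq_compl_last_of_card h2 (by omega))
    · rintro (rfl | ⟨i, rfl⟩ | ⟨h1, h2, h3⟩)
      · refine ⟨Finset.card_pos.mp ?_, by simp⟩
        rw [Finset.card_compl]
        simp only [Fintype.card_fin, Finset.card_singleton]
        omega
      · simpa using (Fin.castSucc_lt_last i).ne'
      · exact ⟨Finset.card_pos.mp (by omega), h3⟩
  have hc : ({Fin.last k}ᶜ : Finset (Fin (k + 1))).card = k := by
    rw [Finset.card_compl]; simp
  have hn : ({Fin.last k}ᶜ : Finset (Fin (k + 1))) ∉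
      ((Finset.univ.image fun i : Fin k => {i.castSucc}) ∪ midFamily k) := by
    simp only [midFamily, Finset.mem_union, Finset.mem_image, Finset.mem_filter, hc,
      Finset.mem_univ, true_and, not_or]
    refine ⟨?_, by omega⟩
    rintro ⟨i, hi⟩
    rw [← hi, Finset.card_singleton] at hc
    omega
  have hd : Disjoint (Finset.univ.image fun i : Fin k => ({i.castSucc} : Finset (Fin (k + 1))))
      (midFamily k) := by
    rw [Finset.disjoint_left]
    intro T hT hT'
    obtain ⟨i, -, rfl⟩ := Finset.mem_image.mp hT
    simp [midFamily] at hT'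
  rw [halfProd, hfam, Finset.prod_insert hn, Finset.prod_union hd, Finset.prod_image,
    sum_compl_eq_neg hx, midProd, Fin.prod_univ_castSucc]
  · simp only [Finset.sum_singleton]
    ring
  · intro i _ j _ h
    simpa using h

lemma properProd_eq_midProd_snoc {K : Type*} [CommRing K] {k : ℕ} (hk : 1 ≤ k)
    (x : Fin (k + 1) → K) :
    properProd x = (∏ i, x i) * midProd (Fin.snoc (α := fun _ => K) x 0) := by
  have hfam : (Finset.univ.filter fun T : Finset (Fin (k + 1)) => T.Nonempty ∧ T ≠ Finset.univ) =
      (Finset.univ.image fun i : Fin (k + 1) => {i}) ∪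
        Finset.univ.filter fun T => 2 ≤ T.card ∧ T.card ≤ k := by
    ext T
    simp only [Finset.mem_filter, Finset.mem_univ, true_and, Finset.mem_union, Finset.mem_image]
    rw [← Finset.card_pos, Ne, ← Finset.card_eq_iff_eq_univ, Fintype.card_fin]
    have h4 : T.card ≤ k + 1 := by simpa using Finset.card_le_univ T
    constructor
    · rintro ⟨h1, h2⟩
      rcases Nat.lt_or_ge T.card 2 with h | h
      · obtain ⟨i, rfl⟩ := Finset.card_eq_one.mp (by omega : T.card = 1)
        exact Or.inl ⟨i, rfl⟩
      · exact Or.inr ⟨h, by omega⟩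
    · rintro (⟨i, rfl⟩ | h)
      · simp; omega
      · omega
  have hd : Disjoint (Finset.univ.image fun i : Fin (k + 1) => ({i} : Finset (Fin (k + 1))))
      (Finset.univ.filter fun T => 2 ≤ T.card ∧ T.card ≤ k) := by
    rw [Finset.disjoint_left]
    intro T hT hT'
    obtain ⟨i, -, rfl⟩ := Finset.mem_image.mp hT
    simp at hT'
  rw [properProd, hfam, Finset.prod_union hd, Finset.prod_image (by intro i _ j _ h; simpa using h)]
  simp only [Finset.sum_singleton]
  congr 1
  refine Finset.prod_bij (fun T _ => T.map Fin.castSuccEmb) ?_ ?_ ?_ ?_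
  · intro T hT
    simp only [Finset.mem_filter, Finset.mem_univ, true_and] at hT
    simp [midFamily, hT.1, hT.2, Fin.castSucc_ne_last]
  · intro T _ U _ h
    exact Finset.map_injective _ h
  · intro T hT
    simp only [midFamily, Finset.mem_filter, Finset.mem_univ, true_and] at hT
    have hT' : (Finset.univ.filter fun i : Fin (k + 1) => i.castSucc ∈ T).map Fin.castSuccEmb
        = T := by
      ext i
      simp only [Finset.mem_map, Finset.mem_filter, Finset.mem_univ, true_and,
        Fin.coe_castSuccEmb]
      constructor
      · rintro ⟨j, hj, rfl⟩
        exact hj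
      · intro hi
        induction i using Fin.lastCases with
        | last => exact absurd hi hT.2.2
        | cast i => exact ⟨i, hi, rfl⟩
    refine ⟨_, ?_, hT'⟩
    have hcard := congrArg Finset.card hT'
    rw [Finset.card_map] at hcard
    simp only [Finset.mem_filter, Finset.mem_univ, true_and, hcard]
    omega
  · intro T _
    simp

/-- The values at `x` of the elementary symmetric polynomials `e₂, …, e_{k+1}`. -/
def esymmPt {K : Type*} [CommRing K] {k : ℕ} (x : Fin (k + 1) → K) : Fin k → K :=
  fun i => ∑ T ∈ Finset.powersetCard ((i : ℕ) + 2) Finset.univ, ∏ j ∈ T, x j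

lemma exists_univ_map_eq {α : Type*} {k : ℕ} (s : Multiset α) (hs : s.card = k) :
    ∃ x : Fin k → α, (Finset.univ : Finset (Fin k)).val.map x = s := by
  induction s using Quotient.inductionOn with
  | h l =>
    have hl : l.length = k := hs
    subst hl
    exact ⟨l.get, by rw [Fin.univ_val_map, List.ofFn_get]; rfl⟩

lemma exists_esymmPt_eq {k : ℕ} (c : Fin k → ℂ) :
    ∃ x : Fin (k + 1) → ℂ, ∑ i, x i = 0 ∧ esymmPt x = c := by
  classical
  let d : ℕ → ℂ := fun j => if h : j < k then (-1) ^ (k + 1 - j) * c ⟨k - 1 - j, by omega⟩ else 0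
  let r : Polynomial ℂ := ∑ j ∈ Finset.range k, Polynomial.monomial j (d j)
  have hr : r.degree < ((k + 1 : ℕ) : WithBot ℕ) := by
    refine (Polynomial.degree_lt_iff_coeff_zero _ _).mpr fun j hj => ?_
    simp only [r, Polynomial.finsetSum_coeff, Polynomial.coeff_monomial]
    refine Finset.sum_eq_zero fun l hl => if_neg ?_
    have := Finset.mem_range.mp hl
    omega
  let p : Polynomial ℂ := Polynomial.X ^ (k + 1) + r
  have hmonic : p.Monic := Polynomial.monic_X_pow_add hr
  have hdeg : p.natDegree = k + 1 := by
    refine Polynomial.natDegree_eq_of_degree_eq_some ?_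
    rw [Polynomial.degree_add_eq_left_of_degree_lt (by rwa [Polynomial.degree_X_pow]),
      Polynomial.degree_X_pow]
  have hcoeff : ∀ j, j ≤ k → p.coeff j = d j := by
    intro j hj
    simp only [p, r, Polynomial.coeff_add, Polynomial.coeff_X_pow, Polynomial.finsetSum_coeff,
      Polynomial.coeff_monomial]
    rw [if_neg (by omega), zero_add, Finset.sum_ite_eq']
    split_ifs with h
    · rfl
    · simp only [Finset.mem_range] at h
      simp [d, h]
  have hcard : p.roots.card = k + 1 :=
    (Polynomial.splits_iff_card_roots.mp (IsAlgClosed.splits p)).trans hdeg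
  obtain ⟨x, hx⟩ := exists_univ_map_eq p.roots hcard
  have key : ∀ j, j ≤ k → d j = (-1) ^ (k + 1 - j) *
      ∑ T ∈ Finset.powersetCard (k + 1 - j) Finset.univ, ∏ l ∈ T, x l := by
    intro j hj
    have := Polynomial.coeff_eq_esymm_roots_of_card (hcard.trans hdeg.symm)
      (by omega : j ≤ p.natDegree)
    rw [hcoeff j hj, hmonic.leadingCoeff, one_mul, hdeg, ← hx, Finset.esymm_map_val] at this
    exact this
  refine ⟨x, ?_, funext fun i => ?_⟩
  · have := key k le_rfl
    simp only [d, lt_irrefl, dite_false, Nat.add_sub_cancel_left, Finset.powersetCard_one,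
      Finset.sum_map, pow_one] at this
    simpa using this.symm
  · have hi := i.isLt
    have := key (k - 1 - i) (by omega)
    have h1 : k + 1 - (k - 1 - (i : ℕ)) = i + 2 := by omega
    have h2 : k - 1 - (k - 1 - (i : ℕ)) = i := by omega
    have h3 : k - 1 - (i : ℕ) < k := by omega
    simp only [d, h1, h2, h3, dite_true] at this
    exact (mul_left_cancel₀ (pow_ne_zero _ (by norm_num)) this).symm

lemma eq_of_eval_esymmPt {k : ℕ} {F G : MvPolynomial (Fin k) ℂ}
    (h : ∀ x : Fin (k + 1) → ℂ, ∑ i, x i = 0 → eval (esymmPt x) F = eval (esymmPt x) G) :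
    F = G := by
  refine MvPolynomial.funext fun c => ?_
  obtain ⟨x, hx, rfl⟩ := exists_esymmPt_eq c
  exact h x hx

/-- A polynomial function which is symmetric on the hyperplane `∑ xᵢ = 0` is there a polynomial
in the elementary symmetric functions `e₂, …, e_{k+1}`. -/
lemma exists_eval_esymmPt_eq {k : ℕ} (p : MvPolynomial (Fin (k + 1)) ℂ)
    (hp : ∀ (σ : Equiv.Perm (Fin (k + 1))) (x : Fin (k + 1) → ℂ), ∑ i, x i = 0 →
      eval (x ∘ σ) p = eval x p) :
    ∃ G : MvPolynomial (Fin k) ℂ, ∀ x : Fin (k + 1) → ℂ, ∑ i, x i = 0 →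
      eval (esymmPt x) G = eval x p := by
  classical
  let N : ℂ := (Fintype.card (Equiv.Perm (Fin (k + 1))) : ℂ)
  have hN : N ≠ 0 := Nat.cast_ne_zero.mpr Fintype.card_ne_zero
  let s : MvPolynomial (Fin (k + 1)) ℂ := ∑ σ : Equiv.Perm (Fin (k + 1)), rename σ p
  have hs : s.IsSymmetric := by
    intro τ
    simp only [s, map_sum, rename_rename]
    exact Fintype.sum_equiv (Equiv.mulLeft τ) _ _ fun σ => rfl
  have hsx : ∀ x : Fin (k + 1) → ℂ, ∑ i, x i = 0 → eval x s = N * eval x p := by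
    intro x hx
    simp only [s, map_sum, eval_rename]
    rw [Finset.sum_congr rfl fun σ _ => hp σ x hx]
    simp [N]
  obtain ⟨F, hF⟩ := esymmAlgHom_surjective ℂ (σ := Fin (k + 1)) (n := k + 1) (by simp) ⟨s, hs⟩
  have hF' : aeval (fun i : Fin (k + 1) => esymm (Fin (k + 1)) ℂ (i + 1)) F = s := by
    have := congrArg Subtype.val hF
    rwa [esymmAlgHom_apply] at this
  refine ⟨C N⁻¹ * aeval (Fin.cases 0 X : Fin (k + 1) → MvPolynomial (Fin k) ℂ) F, fun x hx => ?_⟩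
  have h1 : eval (esymmPt x) (aeval (Fin.cases 0 X : Fin (k + 1) → MvPolynomial (Fin k) ℂ) F)
      = eval x s := by
    rw [← hF', ← coe_aeval_eq_eval, ← coe_aeval_eq_eval]
    simp only [RingHom.coe_coe]
    rw [← AlgHom.comp_apply, ← AlgHom.comp_apply]
    congr 1
    ext i
    induction i using Fin.cases with
    | zero => simp [hx]
    | succ i => simp [esymmPt, esymm]
  rw [map_mul, h1, hsx x hx, eval_C, inv_mul_cancel_left₀ hN]

lemma sum_comp_perm {K : Type*} [CommRing K] {k : ℕ} {x : Fin k → K} (hx : ∑ i, x i = 0)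
    (σ : Equiv.Perm (Fin k)) : ∑ i, (x ∘ σ) i = 0 := by
  rw [← hx]
  exact Equiv.sum_comp σ x

lemma prod_comp_perm {K : Type*} [CommRing K] {k : ℕ} (x : Fin k → K)
    (σ : Equiv.Perm (Fin k)) : ∏ i, (x ∘ σ) i = ∏ i, x i :=
  Equiv.prod_comp σ x

lemma map_halfProd {K L : Type*} [CommRing K] [CommRing L] (φ : K →+* L) {k : ℕ}
    (x : Fin (k + 1) → K) : φ (halfProd x) = halfProd (φ ∘ x) := by
  simp [halfProd]

lemma map_midProd {K L : Type*} [CommRing K] [CommRing L] (φ : K →+* L) {k : ℕ}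
    (x : Fin (k + 1) → K) : φ (midProd x) = midProd (φ ∘ x) := by
  simp [midProd]

/-- The generic point of the hyperplane `∑ xᵢ = 0`. -/
def genPt (k : ℕ) : Fin (k + 1) → MvPolynomial (Fin k) ℂ :=
  Fin.snoc (α := fun _ => MvPolynomial (Fin k) ℂ) X (-∑ j, X j)

/-- Evaluation of a function on the hyperplane `∑ xᵢ = 0` at a point. -/
def evalPt {k : ℕ} (x : Fin (k + 1) → ℂ) : MvPolynomial (Fin k) ℂ →+* ℂ :=
  eval fun j => x j.castSucc

lemma sum_genPt (k : ℕ) : ∑ i, genPt k i = 0 := by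
  simp [genPt, Fin.sum_univ_castSucc]

lemma evalPt_genPt {k : ℕ} {x : Fin (k + 1) → ℂ} (hx : ∑ i, x i = 0) (i : Fin (k + 1)) :
    evalPt x (genPt k i) = x i := by
  rw [Fin.sum_univ_castSucc] at hx
  induction i using Fin.lastCases with
  | last => simpa [evalPt, genPt] using neg_eq_of_add_eq_zero_right hx
  | cast i => simp [evalPt, genPt]

lemma evalPt_comp_genPt {k : ℕ} {x : Fin (k + 1) → ℂ} (hx : ∑ i, x i = 0) :
    evalPt x ∘ genPt k = x := by
  funext i
  rw [Function.comp_apply, evalPt_genPt hx]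

lemma eq_of_evalPt {k : ℕ} {p q : MvPolynomial (Fin k) ℂ}
    (h : ∀ x : Fin (k + 1) → ℂ, ∑ i, x i = 0 → evalPt x p = evalPt x q) : p = q := by
  refine MvPolynomial.funext fun v => ?_
  simpa [evalPt] using h (Fin.snoc (α := fun _ => ℂ) v (-∑ i, v i))
    (by simp [Fin.sum_univ_castSucc])

/-- The point with one coordinate `-k` and all others `1`. -/
def spikePt (k : ℕ) (m : Fin (k + 1)) : Fin (k + 1) → ℂ :=
  fun l => if l = m then -k else 1

lemma sum_spikePt (k : ℕ) (m : Fin (k + 1)) : ∑ i, spikePt k m i = 0 := by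
  simp [spikePt, Finset.sum_ite, Finset.filter_ne', Finset.filter_eq']

lemma sum_spikePt_ne_zero {k : ℕ} (m : Fin (k + 1)) {T : Finset (Fin (k + 1))}
    (h1 : T.Nonempty) (h2 : T ≠ Finset.univ) : ∑ i ∈ T, spikePt k m i ≠ 0 := by
  have key : ∀ U : Finset (Fin (k + 1)), U.Nonempty → m ∉ U → ∑ i ∈ U, spikePt k m i ≠ 0 := by
    intro U hU hm
    have : ∑ i ∈ U, spikePt k m i = ∑ i ∈ U, 1 :=
      Finset.sum_congr rfl fun i hi => if_neg (by rintro rfl; exact hm hi)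
    rw [this]
    simpa using hU.ne_empty
  by_cases hm : m ∈ T
  · have := key Tᶜ (by rwa [Finset.nonempty_iff_ne_empty, Ne, Finset.compl_eq_empty_iff])
      (by simpa using hm)
    rwa [sum_compl_eq_neg (sum_spikePt k m), neg_ne_zero] at this
  · exact key T h1 hm

lemma halfProd_spikePt_ne_zero {k : ℕ} (m : Fin (k + 1)) : halfProd (spikePt k m) ≠ 0 := by
  refine Finset.prod_ne_zero_iff.mpr fun T hT => ?_
  simp only [halfFamily, Finset.mem_filter, Finset.mem_univ, true_and] at hT
  exact sum_spikePt_ne_zero m hT.1 fun h => hT.2 (h ▸ Finset.mem_univ _)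

lemma halfProd_comp_swap {k : ℕ} (hk : 2 ≤ k) (i j : Fin (k + 1)) {x : Fin (k + 1) → ℂ}
    (hx : ∑ i, x i = 0) : halfProd (x ∘ Equiv.swap i j) = halfProd x := by
  have hev : ∀ y : Fin (k + 1) → ℂ, ∑ i, y i = 0 →
      evalPt y (halfProd (genPt k)) = halfProd y ∧
      evalPt y (halfProd (genPt k ∘ Equiv.swap i j)) = halfProd (y ∘ Equiv.swap i j) := by
    intro y hy
    rw [map_halfProd, map_halfProd]
    rw [← Function.comp_assoc, evalPt_comp_genPt hy]
    exact ⟨rfl, rfl⟩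
  have hs : ∑ l, (genPt k ∘ Equiv.swap i j) l = 0 :=
    sum_comp_perm (sum_genPt k) _
  have hsq := properProd_comp_perm (genPt k) (Equiv.swap i j)
  rw [properProd_eq_halfProd_sq hs, properProd_eq_halfProd_sq (sum_genPt k)] at hsq
  have hsq' := mul_left_cancel₀ (pow_ne_zero _ (neg_ne_zero.mpr one_ne_zero)) hsq
  rcases sq_eq_sq_iff_eq_or_eq_neg.mp hsq' with h | h
  · rw [← (hev x hx).1, ← (hev x hx).2, h]
  · exfalso
    obtain ⟨m, hm⟩ : ∃ m, m ∉ ({i, j} : Finset (Fin (k + 1))) := by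
      by_contra! hc
      have h1 := Finset.card_le_card (fun m _ => hc m : Finset.univ ⊆ {i, j})
      have h2 := Finset.card_le_two (a := i) (b := j)
      simp only [Finset.card_univ, Fintype.card_fin] at h1
      omega
    simp only [Finset.mem_insert, Finset.mem_singleton, not_or] at hm
    have hfix : spikePt k m ∘ Equiv.swap i j = spikePt k m := by
      funext l
      have : Equiv.swap i j l = m ↔ l = m := by
        conv_lhs => rw [← Equiv.swap_apply_of_ne_of_ne hm.1 hm.2]
        exact (Equiv.swap i j).injective.eq_iff
      simp only [spikePt, Function.comp_apply, this]
    have hc := congrArg (evalPt (spikePt k m)) h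
    rw [map_neg, (hev _ (sum_spikePt k m)).1, (hev _ (sum_spikePt k m)).2, hfix] at hc
    exact halfProd_spikePt_ne_zero m (CharZero.eq_neg_self_iff.mp hc)

lemma halfProd_comp_perm {k : ℕ} (hk : 2 ≤ k) (σ : Equiv.Perm (Fin (k + 1))) :
    ∀ x : Fin (k + 1) → ℂ, ∑ i, x i = 0 → halfProd (x ∘ σ) = halfProd x := by
  induction σ using Equiv.Perm.swap_induction_on with
  | one => intro x _; rfl
  | swap_mul f i j _ ih =>
    intro x hx
    rw [← halfProd_comp_swap hk i j hx]
    exact ih (x ∘ Equiv.swap i j) (sum_comp_perm hx _)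

lemma prod_genPt_ne_zero {k : ℕ} (hk : 1 ≤ k) : ∏ i, genPt k i ≠ 0 := by
  refine Finset.prod_ne_zero_iff.mpr fun i _ h => ?_
  have h1 := evalPt_genPt (sum_spikePt k i) i
  rw [h, map_zero] at h1
  simp [spikePt] at h1
  omega

lemma midProd_comp_perm {k : ℕ} (hk : 2 ≤ k) (σ : Equiv.Perm (Fin (k + 1)))
    {x : Fin (k + 1) → ℂ} (hx : ∑ i, x i = 0) : midProd (x ∘ σ) = midProd x := by
  have hs : ∑ l, (genPt k ∘ σ) l = 0 :=
    sum_comp_perm (sum_genPt k) σ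
  have h1 : halfProd (genPt k ∘ σ) = halfProd (genPt k) := by
    refine eq_of_evalPt fun y hy => ?_
    rw [map_halfProd, map_halfProd]
    rw [← Function.comp_assoc, evalPt_comp_genPt hy]
    exact halfProd_comp_perm hk σ y hy
  rw [halfProd_eq hk hs, halfProd_eq hk (sum_genPt k)] at h1
  rw [prod_comp_perm] at h1
  have h4 := congrArg (evalPt x)
    (mul_left_cancel₀ (prod_genPt_ne_zero (by omega)) (neg_injective h1))
  rwa [map_midProd, map_midProd, ← Function.comp_assoc, evalPt_comp_genPt hx] at h4

lemma exists_eval_eq_midProd {k : ℕ} (hk : 2 ≤ k) : ∃ G : MvPolynomial (Fin k) ℂ,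
    ∀ x : Fin (k + 1) → ℂ, ∑ i, x i = 0 → eval (esymmPt x) G = midProd x := by
  have hX : ∀ x : Fin (k + 1) → ℂ, eval x (midProd X) = midProd x := by
    intro x
    rw [map_midProd]
    exact congrArg _ (funext fun i => eval_X i)
  obtain ⟨G, hG⟩ := exists_eval_esymmPt_eq (midProd (X : Fin (k + 1) → MvPolynomial _ ℂ))
    fun σ x hx => by rw [hX, hX, midProd_comp_perm hk σ hx]
  exact ⟨G, fun x hx => (hG x hx).trans (hX x)⟩

lemma esymmPt_snoc_zero {k : ℕ} (x : Fin (k + 1) → ℂ) :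
    esymmPt (Fin.snoc (α := fun _ => ℂ) x 0) = Fin.snoc (α := fun _ => ℂ) (esymmPt x) 0 := by
  have key : ∀ j, ∑ T ∈ Finset.powersetCard j Finset.univ,
      ∏ l ∈ T, Fin.snoc (α := fun _ => ℂ) x 0 l =
      ∑ T ∈ Finset.powersetCard j Finset.univ, ∏ l ∈ T, x l := by
    intro j
    rw [← Finset.sum_subset (Finset.powersetCard_mono
      (Finset.subset_univ (Finset.univ.map Fin.castSuccEmb))), Finset.powersetCard_map,
      Finset.sum_map]
    · simp
    · intro T hT hT'
      simp only [Finset.mem_powersetCard, Finset.subset_univ, true_and] at hT hT'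
      have : Fin.last (k + 1) ∈ T := by
        by_contra hl
        refine hT' ⟨fun i hi => ?_, hT⟩
        induction i using Fin.lastCases with
        | last => exact absurd hi hl
        | cast i => simp
      exact Finset.prod_eq_zero this (by simp)
  funext i
  induction i using Fin.lastCases with
  | last =>
    rw [Fin.snoc_last, esymmPt, key, Finset.powersetCard_eq_empty.mpr (by simp), Finset.sum_empty]
  | cast i => rw [Fin.snoc_castSucc, esymmPt, key]; rfl

/-- The last index of `Fin k`. -/
def lastIdx {k : ℕ} (hk : 2 ≤ k) : Fin k := ⟨k - 1, by omega⟩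

lemma esymmPt_lastIdx {K : Type*} [CommRing K] {k : ℕ} (hk : 2 ≤ k) (x : Fin (k + 1) → K) :
    esymmPt x (lastIdx hk) = ∏ i, x i := by
  have : k - 1 + 2 = (Finset.univ : Finset (Fin (k + 1))).card := by simp; omega
  simp only [esymmPt, lastIdx]
  rw [this, Finset.powersetCard_self, Finset.sum_singleton]

lemma killLast_eq {k : ℕ} (hk : 2 ≤ k) {G : MvPolynomial (Fin k) ℂ}
    {H : MvPolynomial (Fin (k + 1)) ℂ}
    (hG : ∀ x : Fin (k + 1) → ℂ, ∑ i, x i = 0 → eval (esymmPt x) G = midProd x)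
    (hH : ∀ x : Fin (k + 2) → ℂ, ∑ i, x i = 0 → eval (esymmPt x) H = midProd x) :
    killLast k H = C ((-1) ^ (halfFamily k).card) * (G * G * X (lastIdx hk)) := by
  refine mul_left_cancel₀ (X_ne_zero (lastIdx hk)) (eq_of_eval_esymmPt fun x hx => ?_)
  have h1 : eval (esymmPt x) (killLast k H) =
      midProd (Fin.snoc (α := fun _ => ℂ) x 0) := by
    rw [← hH _ (by simpa [Fin.sum_univ_castSucc] using hx), esymmPt_snoc_zero, killLast,
      ← coe_aeval_eq_eval, ← coe_aeval_eq_eval]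
    simp only [RingHom.coe_coe]
    rw [← AlgHom.comp_apply]
    congr 1
    ext i
    induction i using Fin.lastCases with
    | last => simp
    | cast i => simp
  have h2 := properProd_eq_midProd_snoc (by omega) x
  rw [properProd_eq_halfProd_sq hx, halfProd_eq hk hx] at h2
  simp only [map_mul, eval_X, h1, eval_C, hG x hx, esymmPt_lastIdx]
  rw [← h2]
  ring

/-- The exponent `(0, 2^{k-3}, …, 2, 1, 0)` of length `k`. -/
def midExp (k : ℕ) : Fin k →₀ ℕ :=
  Finsupp.equivFunOnFinite.symm fun i =>
    if (i : ℕ) = 0 ∨ (i : ℕ) = k - 1 then 0 else 2 ^ (k - i - 2)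

lemma midExp_succ {k : ℕ} (hk : 2 ≤ k) : midExp (k + 1) =
    snocExp (midExp k + midExp k + Finsupp.single (lastIdx hk) 1) 0 := by
  ext i
  induction i using Fin.lastCases with
  | last => simp [midExp, snocExp]
  | cast i =>
    have hi := i.isLt
    simp only [midExp, snocExp, Finsupp.equivFunOnFinite_symm_apply_apply, Fin.val_castSucc,
      Fin.snoc_castSucc, Finsupp.add_apply, Finsupp.single_apply, lastIdx, Fin.ext_iff]
    by_cases h0 : (i : ℕ) = 0
    · simp only [h0, true_or, if_true]
      simp; omega
    · by_cases h1 : (i : ℕ) = k - 1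
      · rw [if_neg (by omega), if_pos (by omega), if_pos h1.symm]
        have : k + 1 - (i : ℕ) - 2 = 0 := by omega
        simp [this]
      · rw [if_neg (by omega), if_neg (by omega), if_neg (Ne.symm h1)]
        have : k + 1 - (i : ℕ) - 2 = k - i - 2 + 1 := by omega
        rw [this, pow_succ]
        ring

lemma hasTrailingExp_midExp {k : ℕ} (hk : 2 ≤ k) : ∀ {G : MvPolynomial (Fin k) ℂ},
    (∀ x : Fin (k + 1) → ℂ, ∑ i, x i = 0 → eval (esymmPt x) G = midProd x) →
    HasTrailingExp G (midExp k) := by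
  induction k, hk using Nat.le_induction with
  | base =>
    intro G hG
    have h1 : G = monomial 0 1 := by
      refine eq_of_eval_esymmPt fun x hx => ?_
      have : midFamily 2 = ∅ := Finset.filter_eq_empty_iff.mpr fun T _ h => by omega
      rw [hG x hx, midProd, this, Finset.prod_empty]
      simp
    have h2 : midExp 2 = 0 := by
      ext i
      have := i.isLt
      simp only [midExp, Finsupp.equivFunOnFinite_symm_apply_apply, Finsupp.coe_zero,
        Pi.zero_apply]
      rw [if_pos (by omega)]
    rw [h1, h2]
    exact hasTrailingExp_monomial 0 one_ne_zero
  | succ k hk ih =>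
    intro H hH
    obtain ⟨G, hG⟩ := exists_eval_eq_midProd hk
    rw [midExp_succ hk]
    refine HasTrailingExp.of_killLast ?_
    rw [killLast_eq hk hG hH, ← zero_add (midExp k + midExp k + _)]
    exact (hasTrailingExp_monomial 0 (pow_ne_zero _ (by norm_num))).mul
      (((ih hG).mul (ih hG)).mul (hasTrailingExp_monomial _ one_ne_zero))

lemma esymmPt_comp_perm {K : Type*} [CommRing K] {k : ℕ} (x : Fin (k + 1) → K)
    (σ : Equiv.Perm (Fin (k + 1))) : esymmPt (x ∘ σ) = esymmPt x := by
  funext i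
  refine Finset.sum_equiv σ.finsetCongr (fun T => ?_) (fun T _ => ?_)
  · simp [Finset.mem_powersetCard]
  · simp

/-- The algebra map sending the variables to the classes of `e₂, …, e_{k+1}`. -/
def esymmHom (k : ℕ) : MvPolynomial (Fin k) ℂ →ₐ[ℂ] MvPolynomial (Fin k) ℂ :=
  aeval (esymmPt (genPt k))

lemma evalPt_esymmHom {k : ℕ} {x : Fin (k + 1) → ℂ} (hx : ∑ i, x i = 0)
    (G : MvPolynomial (Fin k) ℂ) : evalPt x (esymmHom k G) = eval (esymmPt x) G := by
  have h : ∀ i, evalPt x (esymmPt (genPt k) i) = esymmPt x i := by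
    intro i
    simp only [esymmPt, map_sum, map_prod, evalPt_genPt hx]
  induction G using MvPolynomial.induction_on with
  | C a => simp [esymmHom, evalPt]
  | add p q hp hq => rw [map_add, map_add, map_add, hp, hq]
  | mul_X p i hp =>
    rw [map_mul, map_mul, map_mul, hp, eval_X, ← h]
    simp [esymmHom]

lemma esymmHom_injective (k : ℕ) : Function.Injective (esymmHom k) := by
  intro F G h
  refine eq_of_eval_esymmPt fun x hx => ?_
  rw [← evalPt_esymmHom hx, ← evalPt_esymmHom hx, h]

/-- The action of a permutation on the functions on the hyperplane `∑ xᵢ = 0`. -/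
def permHom (k : ℕ) (σ : Equiv.Perm (Fin (k + 1))) :
    MvPolynomial (Fin k) ℂ →ₐ[ℂ] MvPolynomial (Fin k) ℂ :=
  aeval fun j => genPt k (σ j.castSucc)

lemma evalPt_permHom {k : ℕ} {x : Fin (k + 1) → ℂ} (hx : ∑ i, x i = 0)
    (σ : Equiv.Perm (Fin (k + 1))) (a : MvPolynomial (Fin k) ℂ) :
    evalPt x (permHom k σ a) = evalPt (x ∘ σ) a := by
  induction a using MvPolynomial.induction_on with
  | C a => simp [permHom, evalPt]
  | add p q hp hq => rw [map_add, map_add, map_add, hp, hq]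
  | mul_X p i hp =>
    rw [map_mul, map_mul, map_mul, hp, permHom, aeval_X, evalPt_genPt hx]
    simp [evalPt]

lemma forall_permHom_eq_iff {k : ℕ} {a : MvPolynomial (Fin k) ℂ} :
    (∀ σ, permHom k σ a = a) ↔ ∃ G, esymmHom k G = a := by
  constructor
  · intro h
    have hev : ∀ x : Fin (k + 1) → ℂ, eval x (rename Fin.castSucc a) = evalPt x a := by
      intro x
      rw [eval_rename]
      rfl
    obtain ⟨G, hG⟩ := exists_eval_esymmPt_eq (rename Fin.castSucc a) fun σ x hx => by
      rw [hev, hev, ← evalPt_permHom hx, h]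
    exact ⟨G, eq_of_evalPt fun x hx => by rw [evalPt_esymmHom hx, hG x hx, hev]⟩
  · rintro ⟨G, rfl⟩ σ
    refine eq_of_evalPt fun x hx => ?_
    rw [evalPt_permHom hx, evalPt_esymmHom (sum_comp_perm hx σ), evalPt_esymmHom hx,
      esymmPt_comp_perm]

lemma isHomogeneous_genPt {k : ℕ} (i : Fin (k + 1)) : (genPt k i).IsHomogeneous 1 := by
  induction i using Fin.lastCases with
  | last =>
    simp only [genPt, Fin.snoc_last]
    exact (IsHomogeneous.sum _ _ _ fun j _ => isHomogeneous_X ℂ j).neg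
  | cast i =>
    simp only [genPt, Fin.snoc_castSucc]
    exact isHomogeneous_X ℂ i

lemma isHomogeneous_esymmPt_genPt {k : ℕ} (i : Fin k) :
    (esymmPt (genPt k) i).IsHomogeneous ((i : ℕ) + 2) := by
  refine IsHomogeneous.sum _ _ _ fun T hT => ?_
  have := IsHomogeneous.prod T (genPt k) (fun _ => 1) fun i _ => isHomogeneous_genPt i
  simpa [(Finset.mem_powersetCard.mp hT).2] using this

/-- The degree of the monomial in `e₂, …, e_{k+1}` with exponent `b`. -/
def expWeight {k : ℕ} (b : Fin k →₀ ℕ) : ℕ := ∑ i : Fin k, ((i : ℕ) + 2) * b i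

lemma expWeight_add {k : ℕ} (a b : Fin k →₀ ℕ) :
    expWeight (a + b) = expWeight a + expWeight b := by
  simp [expWeight, mul_add, Finset.sum_add_distrib]

lemma esymmHom_monomial {k : ℕ} (b : Fin k →₀ ℕ) (c : ℂ) :
    esymmHom k (monomial b c) = C c * ∏ i, esymmPt (genPt k) i ^ b i := by
  rw [esymmHom, aeval_monomial, Finsupp.prod_fintype _ _ (by simp), algebraMap_eq]

lemma isHomogeneous_esymmHom_monomial {k : ℕ} (b : Fin k →₀ ℕ) (c : ℂ) :
    (esymmHom k (monomial b c)).IsHomogeneous (expWeight b) := by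
  rw [esymmHom_monomial, ← zero_add (expWeight b)]
  exact (isHomogeneous_C _ c).mul
    (IsHomogeneous.prod _ _ _ fun i _ => (isHomogeneous_esymmPt_genPt i).pow (b i))

/-- The part of weighted degree `g`. -/
def weightPart {k : ℕ} (g : ℕ) (G : MvPolynomial (Fin k) ℂ) : MvPolynomial (Fin k) ℂ :=
  ∑ b ∈ G.support with expWeight b = g, monomial b (coeff b G)

lemma coeff_weightPart {k : ℕ} (g : ℕ) (G : MvPolynomial (Fin k) ℂ) (b : Fin k →₀ ℕ) :
    coeff b (weightPart g G) = if expWeight b = g then coeff b G else 0 := by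
  classical
  simp only [weightPart, coeff_sum, coeff_monomial, Finset.sum_ite_eq', Finset.mem_filter,
    mem_support_iff]
  by_cases h : coeff b G = 0 <;> simp [h]

lemma homogeneousComponent_esymmHom {k : ℕ} (g : ℕ) (G : MvPolynomial (Fin k) ℂ) :
    homogeneousComponent g (esymmHom k G) = esymmHom k (weightPart g G) := by
  conv_lhs => rw [G.as_sum, map_sum, map_sum]
  rw [weightPart, map_sum, Finset.sum_filter]
  refine Finset.sum_congr rfl fun b _ => ?_
  rw [homogeneousComponent_of_mem
    ((mem_homogeneousSubmodule _ _).mpr (isHomogeneous_esymmHom_monomial b _))]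
  simp only [eq_comm]

lemma expWeight_eq_of_isHomogeneous {k g : ℕ} {G : MvPolynomial (Fin k) ℂ}
    (h : (esymmHom k G).IsHomogeneous g) {b : Fin k →₀ ℕ} (hb : coeff b G ≠ 0) :
    expWeight b = g := by
  have h1 := homogeneousComponent_esymmHom g G
  rw [homogeneousComponent_of_mem ((mem_homogeneousSubmodule _ _).mpr h), if_pos rfl] at h1
  have h2 := coeff_weightPart g G b
  rw [← esymmHom_injective k h1] at h2
  by_contra hne
  rw [if_neg hne] at h2
  exact hb h2

lemma eq_zero_of_dvd_of_not_le {k : ℕ} {Q G : MvPolynomial (Fin k) ℂ} {e : Fin k →₀ ℕ}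
    (hQ : HasTrailingExp Q e) (hG : ∀ b, coeff b G ≠ 0 → ¬ e ≤ b) (h : Q ∣ G) : G = 0 := by
  obtain ⟨F, rfl⟩ := h
  by_contra hne
  obtain ⟨a, ha⟩ := exists_hasTrailingExp (right_ne_zero_of_mul hne)
  exact hG _ (hQ.mul ha).1 le_self_add

lemma finite_expWeight_eq (k g : ℕ) : {b : Fin k →₀ ℕ | expWeight b = g}.Finite := by
  refine Set.Finite.subset (Set.finite_Iic (Finsupp.equivFunOnFinite.symm fun _ : Fin k => g))
    fun b hb => ?_
  rw [Set.mem_Iic, Finsupp.le_def]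
  intro i
  rw [Set.mem_ofPred_eq] at hb
  rw [Finsupp.equivFunOnFinite_symm_apply_apply, ← hb]
  calc b i ≤ ((i : ℕ) + 2) * b i := Nat.le_mul_of_pos_left _ (by omega)
    _ ≤ expWeight b := Finset.single_le_sum (f := fun i : Fin k => ((i : ℕ) + 2) * b i)
      (fun _ _ => Nat.zero_le _) (Finset.mem_univ i)

/-- Division by a polynomial whose trailing exponent is `e`: a subspace containing the images of
the multiples `Q * monomial` of weighted degree `g` and of the monomials of weighted degree `g`
not divisible by the monomial with exponent `e` contains all monomials of weighted degree `g`. -/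
lemma esymmHom_monomial_mem {k g : ℕ} {Q : MvPolynomial (Fin k) ℂ} {e : Fin k →₀ ℕ}
    (hQ : HasTrailingExp Q e) (hQw : ∀ b, coeff b Q ≠ 0 → expWeight b = expWeight e)
    (V : Submodule ℂ (MvPolynomial (Fin k) ℂ))
    (h1 : ∀ b, expWeight (e + b) = g → esymmHom k (Q * monomial b 1) ∈ V)
    (h2 : ∀ b, expWeight b = g → ¬ e ≤ b → esymmHom k (monomial b 1) ∈ V)
    (b : Fin k →₀ ℕ) (hb : expWeight b = g) : esymmHom k (monomial b 1) ∈ V := by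
  have hwf : {b : Fin k →₀ ℕ | expWeight b = g}.WellFoundedOn
      fun a b => toColex b < toColex a := by
    have : IsStrictOrder (Fin k →₀ ℕ) fun a b => toColex b < toColex a :=
      { irrefl := fun a => lt_irrefl (toColex a)
        trans := fun _ _ _ h h' => lt_trans h' h }
    exact (finite_expWeight_eq k g).wellFoundedOn
  refine hwf.induction (P := fun b => esymmHom k (monomial b 1) ∈ V) hb fun b hb ih => ?_
  by_cases he : e ≤ b
  · obtain ⟨d, rfl⟩ := exists_add_of_le he
    have hP := hQ.mul (hasTrailingExp_monomial d one_ne_zero)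
    have hPw : ∀ b, coeff b (Q * monomial d 1) ≠ 0 → expWeight b = g := by
      intro b hb'
      rw [coeff_mul_monomial', mul_one] at hb'
      split_ifs at hb' with hd
      · rw [← hb, expWeight_add, ← hQw _ hb', ← expWeight_add, tsub_add_cancel_of_le hd]
      · exact absurd rfl hb'
    have hsum : esymmHom k (Q * monomial d 1) = ∑ b ∈ (Q * monomial d 1).support,
        coeff b (Q * monomial d 1) • esymmHom k (monomial b 1) := by
      conv_lhs => rw [as_sum (Q * monomial d 1), map_sum]
      refine Finset.sum_congr rfl fun b _ => ?_
      rw [← map_smul, smul_monomial, smul_eq_mul, mul_one]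
    have hmem := h1 d hb
    rw [hsum, ← Finset.add_sum_erase _ _ (mem_support_iff.mpr hP.1)] at hmem
    have hrest : ∑ b ∈ (Q * monomial d 1).support.erase (e + d),
        coeff b (Q * monomial d 1) • esymmHom k (monomial b 1) ∈ V := by
      refine V.sum_mem fun b hb' => V.smul_mem _ ?_
      obtain ⟨hne, hb'⟩ := Finset.mem_erase.mp hb'
      rw [mem_support_iff] at hb'
      exact ih b (hPw b hb') (lt_of_le_of_ne (hP.2 b hb') fun h => hne (toColex.injective h).symm)
    exact (V.smul_mem_iff hP.1).mp ((V.add_mem_iff_left hrest).mp hmem)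
  · exact h2 b hb he

lemma lamb_eq_genPt (k : ℕ) : lamb (k + 1) = genPt k := by
  funext i
  induction i using Fin.lastCases with
  | last => simp [lamb, genPt]
  | cast i => simp [lamb, genPt]

lemma ebar_eq_esymmPt {k : ℕ} (i : Fin k) : ebar (k + 1) ((i : ℕ) + 2) = esymmPt (genPt k) i := by
  rw [ebar, lamb_eq_genPt]
  rfl

lemma permAct_eq_permHom {k : ℕ} (σ : Equiv.Perm (Fin (k + 1))) :
    permAct (k + 1) σ = permHom k σ := by
  rw [permAct, lamb_eq_genPt]
  rfl

lemma mem_SigmaBar_iff {k g : ℕ} {a : MvPolynomial (Fin k) ℂ} :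
    a ∈ SigmaBar (k + 1) g ↔ a.IsHomogeneous g ∧ ∃ G, esymmHom k G = a := by
  rw [← forall_permHom_eq_iff, SigmaBar, Submodule.mem_inf, Submodule.mem_iInf]
  refine and_congr Iff.rfl (forall_congr' fun σ => ?_)
  rw [LinearMap.mem_ker, LinearMap.sub_apply, sub_eq_zero, permAct_eq_permHom]
  rfl

/-- The nonempty subsets of size less than half of the index set, together with those of exactly
half the size which contain the first index. -/
def lowerFamily (k : ℕ) : Finset (Finset (Fin (k + 1))) :=
  Finset.univ.filter fun T => T.Nonempty ∧
    (2 * T.card < k + 1 ∨ 2 * T.card = k + 1 ∧ 0 ∈ T)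

/-- The polynomial `qP (k + 1)`, regarded as a polynomial in `k` variables. -/
def qPoly (k : ℕ) : MvPolynomial (Fin k) ℂ := qP (k + 1)

lemma qPoly_eq_prod_lowerFamily (k : ℕ) :
    qPoly k = ∏ T ∈ lowerFamily k, ∑ i ∈ T, genPt k i := by
  rw [qPoly, qP, ← Finset.prod_fiberwise_of_maps_to (g := Finset.card) (t := Finset.Icc 1 ((k + 1) / 2))]
  · refine Finset.prod_congr rfl fun h hh => ?_
    rw [Finset.mem_Icc] at hh
    have h0 : ∀ T : Finset (Fin (k + 1)), (∃ i : Fin (k + 1), i ∈ T ∧ (i : ℕ) = 0) ↔ 0 ∈ T := by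
      intro T
      constructor
      · rintro ⟨i, hi, h⟩
        have hi0 : i = 0 := Fin.ext h
        rwa [hi0] at hi
      · exact fun h => ⟨0, h, rfl⟩
    simp only [pP, lamT, lamb_eq_genPt]
    split_ifs with hlt
    · refine Finset.prod_congr ?_ fun _ _ => rfl
      ext T
      simp only [lowerFamily, Finset.mem_powersetCard_univ, Finset.mem_filter, Finset.mem_univ,
        true_and, ← Finset.card_pos]
      constructor
      · rintro rfl
        exact ⟨⟨by omega, Or.inl hlt⟩, rfl⟩
      · exact fun h => h.2
    · refine Finset.prod_congr ?_ fun _ _ => rfl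
      ext T
      simp only [lowerFamily, Finset.mem_powersetCard_univ, Finset.mem_filter, Finset.mem_univ,
        true_and, ← Finset.card_pos, h0]
      constructor
      · rintro ⟨rfl, h⟩
        exact ⟨⟨by omega, Or.inr ⟨by omega, h⟩⟩, rfl⟩
      · rintro ⟨⟨-, h | h⟩, rfl⟩
        · omega
        · exact ⟨rfl, h.2⟩
  · intro T hT
    simp only [lowerFamily, Finset.mem_filter, Finset.mem_univ, true_and] at hT
    have := Finset.card_pos.mpr hT.1
    rw [Finset.mem_Icc]
    omega

lemma properProd_eq_qPoly_sq (k : ℕ) :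
    properProd (genPt k) = (-1) ^ (lowerFamily k).card * qPoly k ^ 2 := by
  rw [qPoly_eq_prod_lowerFamily]
  refine properProd_eq_sq (sum_genPt k) _ (fun T hT => ?_) (fun T h1 h2 => ?_)
  · simp only [lowerFamily, Finset.mem_filter, Finset.mem_univ, true_and] at hT
    refine ⟨hT.1, ?_⟩
    rintro rfl
    simp only [Finset.card_univ, Fintype.card_fin] at hT
    omega
  · have h3 : Tᶜ.Nonempty := by rwa [Finset.nonempty_iff_ne_empty, Ne, Finset.compl_eq_empty_iff]
    have h4 := Finset.card_add_card_compl T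
    rw [Fintype.card_fin] at h4
    simp only [lowerFamily, Finset.mem_filter, Finset.mem_univ, true_and, h1, h3,
      Finset.mem_compl]
    by_cases h0 : (0 : Fin (k + 1)) ∈ T <;> simp only [h0, not_true, not_false_iff, and_true,
      and_false, or_false] <;> omega

lemma isHomogeneous_qPoly (k : ℕ) :
    ∃ d, (qPoly k).IsHomogeneous d := by
  rw [qPoly_eq_prod_lowerFamily]
  exact ⟨_, IsHomogeneous.prod _ _ (fun _ => 1) fun T _ =>
    IsHomogeneous.sum _ _ _ fun i _ => isHomogeneous_genPt i⟩

/-- The exponent `nvec` as a finitely supported function. -/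
def nvecExp (k : ℕ) : Fin k →₀ ℕ :=
  Finsupp.equivFunOnFinite.symm (nvec (k + 1))

lemma nvecExp_eq {k : ℕ} (hk : 2 ≤ k) :
    nvecExp k = midExp k + Finsupp.single (lastIdx hk) 1 := by
  ext i
  have hi := i.isLt
  simp only [nvecExp, nvec, midExp, Finsupp.equivFunOnFinite_symm_apply_apply, Finsupp.add_apply,
    Finsupp.single_apply, lastIdx, Fin.ext_iff]
  by_cases h0 : (i : ℕ) = 0
  · rw [if_pos h0, if_pos (Or.inl h0), if_neg (by omega), add_zero]
  · by_cases h1 : (i : ℕ) = k - 1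
    · rw [if_neg h0, if_pos (by omega), if_pos (Or.inr h1), if_pos h1.symm, zero_add]
    · rw [if_neg h0, if_neg (by omega), if_neg (by omega), if_neg (Ne.symm h1), add_zero]
      congr 1
      omega

lemma exists_esymmHom_eq_qPoly {k : ℕ} (hk : 2 ≤ k) :
    ∃ Q, esymmHom k Q = qPoly k ∧ HasTrailingExp Q (nvecExp k) := by
  obtain ⟨R, hR⟩ := exists_eval_eq_midProd hk
  have hRm : esymmHom k R = midProd (genPt k) := by
    refine eq_of_evalPt fun x hx => ?_
    rw [evalPt_esymmHom hx, hR x hx, map_midProd, evalPt_comp_genPt hx]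
  have hhalf : halfProd (genPt k) = -esymmHom k (R * X (lastIdx hk)) := by
    rw [halfProd_eq hk (sum_genPt k), map_mul, hRm, mul_comm]
    congr 2
    rw [esymmHom, aeval_X, esymmPt_lastIdx]
  have hq := properProd_eq_qPoly_sq k
  rw [properProd_eq_halfProd_sq (sum_genPt k), hhalf] at hq
  obtain ⟨c, hc0, hc⟩ : ∃ c : ℂ, c ≠ 0 ∧
      qPoly k = esymmHom k (C c * (R * X (lastIdx hk))) := by
    have hI : ∀ m : ℕ, ((-1) ^ m : MvPolynomial (Fin k) ℂ) = C (Complex.I ^ m) ^ 2 := by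
      intro m
      rw [← C_pow, ← pow_mul, mul_comm, pow_mul, Complex.I_sq]
      simp
    have hC : ∀ c : ℂ, esymmHom k (C c) = C c := fun c => by
      rw [← algebraMap_eq, AlgHom.commutes]
    have hI0 : ∀ m : ℕ, Complex.I ^ m ≠ 0 := fun m => pow_ne_zero _ Complex.I_ne_zero
    have hI' : ∀ m : ℕ,
        (C (Complex.I ^ m)⁻¹ : MvPolynomial (Fin k) ℂ) * C (Complex.I ^ m) = 1 := by
      intro m
      rw [← C_mul, inv_mul_cancel₀ (hI0 m), C_1]
    rw [hI, hI, neg_sq, ← mul_pow, ← mul_pow] at hq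
    have hcalc : ∀ u : ℂ, C u * esymmHom k (R * X (lastIdx hk)) =
        C (Complex.I ^ (lowerFamily k).card) * qPoly k →
        qPoly k =
          esymmHom k (C ((Complex.I ^ (lowerFamily k).card)⁻¹ * u) * (R * X (lastIdx hk))) := by
      intro u hu
      rw [map_mul, hC, C_mul, mul_assoc, hu, ← mul_assoc, hI', one_mul]
    rcases sq_eq_sq_iff_eq_or_eq_neg.mp hq with h | h
    · exact ⟨_, mul_ne_zero (inv_ne_zero (hI0 _)) (hI0 _), hcalc _ h⟩
    · refine ⟨_, mul_ne_zero (inv_ne_zero (hI0 _)) (neg_ne_zero.mpr (hI0 _)),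
        hcalc (-Complex.I ^ (halfFamily k).card) ?_⟩
      rw [C_neg, neg_mul, h, neg_neg]
  refine ⟨_, hc.symm, ?_⟩
  rw [nvecExp_eq hk, ← zero_add (midExp k + _)]
  exact (hasTrailingExp_monomial 0 hc0).mul
    ((hasTrailingExp_midExp hk hR).mul (hasTrailingExp_monomial _ one_ne_zero))

/-- The monomials `ē₂^{h₂}⋯ē_{k+1}^{h_{k+1}}` of degree `g` with `h` not above `nvec`. -/
def lowMonomials (k g : ℕ) : Set (MvPolynomial (Fin k) ℂ) :=
  {x | ∃ b : Fin k →₀ ℕ, expWeight b = g ∧ ¬ nvecExp k ≤ b ∧ x = esymmHom k (monomial b 1)}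

lemma setOf_eq_lowMonomials (k g : ℕ) :
    {x : MvPolynomial (Fin (k + 1 - 1)) ℂ | ∃ h : Fin (k + 1 - 1) → ℕ,
      (∑ i : Fin (k + 1 - 1), ((i : ℕ) + 2) * h i = g) ∧ ¬ nvec (k + 1) ≤ h ∧
        x = ∏ i : Fin (k + 1 - 1), ebar (k + 1) ((i : ℕ) + 2) ^ h i} = lowMonomials k g := by
  have hprod : ∀ h : Fin k → ℕ, ∏ i : Fin k, ebar (k + 1) ((i : ℕ) + 2) ^ h i =
      esymmHom k (monomial (Finsupp.equivFunOnFinite.symm h) 1) := by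
    intro h
    rw [esymmHom_monomial, C_1, one_mul]
    exact Finset.prod_congr rfl fun i _ => by rw [ebar_eq_esymmPt]; rfl
  ext x
  constructor
  · rintro ⟨h, h1, h2, rfl⟩
    exact ⟨Finsupp.equivFunOnFinite.symm h, h1, h2, hprod h⟩
  · rintro ⟨b, h1, h2, rfl⟩
    refine ⟨b, h1, h2, ?_⟩
    rw [← Finsupp.equivFunOnFinite_symm_coe b]
    exact (hprod b).symm

lemma exists_of_mem_span_lowMonomials {k g : ℕ} {x : MvPolynomial (Fin k) ℂ}
    (hx : x ∈ Submodule.span ℂ (lowMonomials k g)) :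
    ∃ G, esymmHom k G = x ∧ ∀ b, coeff b G ≠ 0 → ¬ nvecExp k ≤ b := by
  classical
  induction hx using Submodule.span_induction with
  | mem x hx =>
    obtain ⟨b, -, hb, rfl⟩ := hx
    refine ⟨_, rfl, fun c hc => ?_⟩
    rw [coeff_monomial] at hc
    split_ifs at hc with h
    · exact h ▸ hb
    · exact absurd rfl hc
  | zero => exact ⟨0, map_zero _, fun b hb => absurd (coeff_zero b) hb⟩
  | add x y _ _ hx hy =>
    obtain ⟨F, rfl, hF⟩ := hx
    obtain ⟨G, rfl, hG⟩ := hy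
    refine ⟨F + G, map_add _ _ _, fun b hb => ?_⟩
    rw [coeff_add] at hb
    by_cases h : coeff b F = 0
    · exact hG b fun h' => hb (by rw [h, h', add_zero])
    · exact hF b h
  | smul c x _ hx =>
    obtain ⟨F, rfl, hF⟩ := hx
    refine ⟨c • F, map_smul _ _ _, fun b hb => hF b fun h => hb ?_⟩
    rw [coeff_smul, h, smul_zero]

lemma exists_esymmHom_of_mul {k : ℕ} {q a : MvPolynomial (Fin k) ℂ} (hq0 : q ≠ 0)
    (hq : ∃ Q, esymmHom k Q = q) (h : ∃ G, esymmHom k G = q * a) : ∃ F, esymmHom k F = a := by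
  rw [← forall_permHom_eq_iff] at *
  intro σ
  have := h σ
  rw [map_mul, hq σ] at this
  exact mul_left_cancel₀ hq0 this

lemma multiples_inf_span_eq_bot {k : ℕ} (hk : 2 ≤ k) (g : ℕ) :
    (SigmaBar (k + 1) g ⊓ (Ideal.span {qP (k + 1)}).restrictScalars ℂ) ⊓
      Submodule.span ℂ (lowMonomials k g) = ⊥ := by
  rw [eq_bot_iff]
  rintro x ⟨⟨hx, hxq⟩, hxs⟩
  obtain ⟨Q, hQ, hQe⟩ := exists_esymmHom_eq_qPoly hk
  obtain ⟨G, rfl, hG⟩ := exists_of_mem_span_lowMonomials hxs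
  obtain ⟨a, ha⟩ : ∃ a : MvPolynomial (Fin k) ℂ, esymmHom k G = qPoly k * a :=
    Ideal.mem_span_singleton.mp hxq
  have hq0 : qPoly k ≠ 0 := by
    rw [← hQ, Ne, map_eq_zero_iff _ (esymmHom_injective k)]
    rintro rfl
    exact hQe.1 (coeff_zero _)
  obtain ⟨F, rfl⟩ := exists_esymmHom_of_mul hq0 ⟨Q, hQ⟩ ⟨G, ha⟩
  have hGQ : G = Q * F := esymmHom_injective k (by rw [map_mul, hQ]; exact ha)
  rw [eq_zero_of_dvd_of_not_le hQe hG ⟨F, hGQ⟩, map_zero]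
  exact Submodule.zero_mem _

lemma multiples_sup_span_eq {k : ℕ} (hk : 2 ≤ k) (g : ℕ) :
    (SigmaBar (k + 1) g ⊓ (Ideal.span {qP (k + 1)}).restrictScalars ℂ) ⊔
      Submodule.span ℂ (lowMonomials k g) = SigmaBar (k + 1) g := by
  apply le_antisymm
  · refine sup_le inf_le_left (Submodule.span_le.mpr ?_)
    rintro x ⟨b, rfl, -, rfl⟩
    exact mem_SigmaBar_iff.mpr ⟨isHomogeneous_esymmHom_monomial b 1, _, rfl⟩
  · intro a ha
    obtain ⟨hag, G, rfl⟩ := mem_SigmaBar_iff.mp ha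
    obtain ⟨Q, hQ, hQe⟩ := exists_esymmHom_eq_qPoly hk
    obtain ⟨d, hd⟩ := isHomogeneous_qPoly k
    rw [← hQ] at hd
    have hde := expWeight_eq_of_isHomogeneous hd hQe.1
    rw [G.as_sum, map_sum]
    refine Submodule.sum_mem _ fun b hb => ?_
    have hbg := expWeight_eq_of_isHomogeneous hag (mem_support_iff.mp hb)
    have hsmul : monomial b (coeff b G) = coeff b G • monomial b (1 : ℂ) := by
      rw [smul_monomial, smul_eq_mul, mul_one]
    rw [hsmul, map_smul]
    refine Submodule.smul_mem _ _ (esymmHom_monomial_mem hQe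
      (fun c hc => (expWeight_eq_of_isHomogeneous hd hc).trans hde.symm) _ ?_ ?_ b hbg)
    · intro c hc
      refine Submodule.mem_sup_left ⟨mem_SigmaBar_iff.mpr ⟨?_, _, rfl⟩, ?_⟩
      · rw [map_mul, ← hc, expWeight_add, hde]
        exact hd.mul (isHomogeneous_esymmHom_monomial c 1)
      · rw [map_mul, hQ]
        exact Ideal.mem_span_singleton.mpr (dvd_mul_right _ _)
    · exact fun c hc hce => Submodule.mem_sup_right (Submodule.subset_span ⟨c, hc, hce, rfl⟩)

/-- for `n ≥ 3`, `Σ̄_{n,g}` is the direct sum of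
`O_{n,g} = Σ̄_{n,g} ∩ qₙ·Aₙ` and the ℂ-span of the monomials `ē₂^{h₂}⋯ēₙ^{hₙ}` with
`2h₂+⋯+nhₙ = g` and `(h₂,…,hₙ) ⋡ 𝐧`. -/
theorem stmt18 (n : ℕ) (hn : 3 ≤ n) (g : ℕ) :
    (SigmaBar n g ⊓ (Ideal.span {qP n}).restrictScalars ℂ) ⊓
        Submodule.span ℂ
          {x : MvPolynomial (Fin (n - 1)) ℂ | ∃ h : Fin (n - 1) → ℕ,
            (∑ i : Fin (n - 1), ((i : ℕ) + 2) * h i = g) ∧ ¬ nvec n ≤ h ∧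
              x = ∏ i : Fin (n - 1), ebar n ((i : ℕ) + 2) ^ h i} = ⊥ ∧
    (SigmaBar n g ⊓ (Ideal.span {qP n}).restrictScalars ℂ) ⊔
        Submodule.span ℂ
          {x : MvPolynomial (Fin (n - 1)) ℂ | ∃ h : Fin (n - 1) → ℕ,
            (∑ i : Fin (n - 1), ((i : ℕ) + 2) * h i = g) ∧ ¬ nvec n ≤ h ∧
              x = ∏ i : Fin (n - 1), ebar n ((i : ℕ) + 2) ^ h i} = SigmaBar n g := by
  obtain ⟨k, rfl⟩ : ∃ k, n = k + 1 := ⟨n - 1, by omega⟩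
  rw [setOf_eq_lowMonomials]
  exact ⟨multiples_inf_span_eq_bot (by omega) g, multiples_sup_span_eq (by omega) g⟩
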